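/- Assume char K ≠ 2 and X is a connected locally finite poset satisfying condition (M). Let λ be an involution on X, (X₁, X₂, X₃) a λ-decomposition of X, and for a map ε : X₃ → K* let u_ε ∈ A be the diagonal element with u_ε(x,x) = 1 for x ∈ X₁ ∪ X₂, u_ε(x,x) = ε(x) for x ∈ X₃, and u_ε(x,y) = 0 for x ≠ y, and set ρ_ε = Ψ_{u_ε} ∘ ρ_λ (an involution on A). Then for maps ε₁, ε₂ : X₃ → K*, the involutions ρ_{ε₁} and ρ_{ε₂} are equivalent via an inner automorphism of A (i.e., there is a unit u ∈ A with Ψ_u ∘ ρ_{ε₁} = ρ_{ε₂} ∘ Ψ_u) if and only if there exists g ∈ K* such that for every x ∈ X₃, ε₂(x)·(g·ε₁(x))⁻¹ is a square in K*. -/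

import Mathlib

open TrivSqZeroExt

variable (K X : Type*) [Field K] [PartialOrder X] [LocallyFiniteOrder X] [DecidableEq X]

/-- The anti-automorphism `ρ_λ` of the incidence algebra induced by an order
anti-automorphism `lam` of `X`: `ρ_λ(f)(x,y) = f(λ(y), λ(x))`. -/
def rhoLam (lam : X → X) (hlam : ∀ x y : X, x ≤ y ↔ lam y ≤ lam x)
    (f : IncidenceAlgebra K X) : IncidenceAlgebra K X :=
  ⟨fun x y => f (lam y) (lam x), fun x y hxy =>
    IncidenceAlgebra.apply_eq_zero_of_not_le (fun h => hxy ((hlam x y).mpr h)) f⟩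

/-- The anti-automorphism `ρ̃_λ` of `D(X,K)`: `(f,i) ↦ (ρ_λ(f), ρ_λ(i))`. -/
def rhoTilde (lam : X → X) (hlam : ∀ x y : X, x ≤ y ↔ lam y ≤ lam x)
    (d : TrivSqZeroExt (IncidenceAlgebra K X) (IncidenceAlgebra K X)) :
    TrivSqZeroExt (IncidenceAlgebra K X) (IncidenceAlgebra K X) :=
  inl (rhoLam K X lam hlam d.fst) + inr (rhoLam K X lam hlam d.snd)

/-- The automorphism `k̃δ` of `D(X,K)`: `(f,i) ↦ (f, k·i)`. -/
def kTilde (k : K) (d : TrivSqZeroExt (IncidenceAlgebra K X) (IncidenceAlgebra K X)) :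
    TrivSqZeroExt (IncidenceAlgebra K X) (IncidenceAlgebra K X) :=
  inl d.fst + inr (k • d.snd)

/-- Condition (M): every multiplicative automorphism of `I(X,K)` is inner. -/
def CondM : Prop :=
  ∀ σ : X → X → K, (∀ x y : X, x ≤ y → σ x y ≠ 0) →
    (∀ x y z : X, x ≤ y → y ≤ z → σ x y * σ y z = σ x z) →
    ∃ u : (IncidenceAlgebra K X)ˣ, ∀ (f : IncidenceAlgebra K X) (x y : X), x ≤ y →
      (↑u * f * ↑u⁻¹ : IncidenceAlgebra K X) x y = σ x y * f x y

/-- Condition (D): every `K`-linear derivation of `I(X,K)` is inner. -/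
def CondD : Prop :=
  ∀ Der : IncidenceAlgebra K X → IncidenceAlgebra K X,
    (∀ f g, Der (f + g) = Der f + Der g) →
    (∀ (k : K) (f : IncidenceAlgebra K X), Der (k • f) = k • Der f) →
    (∀ f g, Der (f * g) = Der f * g + f * Der g) →
    ∃ i : IncidenceAlgebra K X, ∀ f, Der f = f * i - i * f

/-- Connectedness of the poset `X`. -/
def PosetConnected : Prop :=
  ∀ x y : X, Relation.ReflTransGen (fun a b : X => a ≤ b ∨ b ≤ a) x y

/-- For a map `ε : X₃ → K*`, the diagonal element `u_ε` with `u_ε(x,x) = 1` for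
`x ∉ X₃` (i.e. `x ∈ X₁ ∪ X₂`), `u_ε(x,x) = ε(x)` for `x ∈ X₃`, and `u_ε(x,y) = 0`
for `x ≠ y`. -/
noncomputable def uEps (K X : Type*) [Field K] [PartialOrder X] [LocallyFiniteOrder X]
    [DecidableEq X] (X₃ : Set X) (eps : {x : X // x ∈ X₃} → Kˣ) : IncidenceAlgebra K X :=
  open Classical in
  ⟨fun x y => if h : x = y then (if h3 : x ∈ X₃ then (eps ⟨x, h3⟩ : K) else 1) else 0,
    fun a b hab => dif_neg (fun h => hab (le_of_eq h))⟩

/-- The involution `ρ_ε = Ψ_{u_ε} ∘ ρ_λ` on `I(X,K)` (here `u_ε⁻¹` is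
`Ring.inverse u_ε`). -/
noncomputable def rhoEps (K X : Type*) [Field K] [PartialOrder X] [LocallyFiniteOrder X]
    [DecidableEq X] (X₃ : Set X) (eps : {x : X // x ∈ X₃} → Kˣ) (lam : X → X)
    (hlam : ∀ x y : X, x ≤ y ↔ lam y ≤ lam x) (f : IncidenceAlgebra K X) :
    IncidenceAlgebra K X :=
  uEps K X X₃ eps * rhoLam K X lam hlam f * Ring.inverse (uEps K X X₃ eps)

namespace IncidenceAlgebra

variable {K X : Type*} [Field K] [PartialOrder X] [LocallyFiniteOrder X] [DecidableEq X]

omit [DecidableEq X] in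
lemma mul_apply_self (f g : IncidenceAlgebra K X) (x : X) : (f * g) x x = f x x * g x x := by
  simp

/-- The diagonal element with diagonal entries `d`. -/
def diagonal (d : X → K) : IncidenceAlgebra K X :=
  ⟨fun x y => if x = y then d x else 0, fun _ _ h => if_neg fun e => h e.le⟩

omit [LocallyFiniteOrder X] in
lemma diagonal_apply (d : X → K) (x y : X) : diagonal d x y = if x = y then d x else 0 := rfl

lemma diagonal_mul_apply (d : X → K) (f : IncidenceAlgebra K X) (x y : X) :
    (diagonal d * f) x y = d x * f x y := by
  by_cases h : x ≤ y
  · simp [diagonal_apply, h]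
  · simp [apply_eq_zero_of_not_le h]

lemma mul_diagonal_apply (d : X → K) (f : IncidenceAlgebra K X) (x y : X) :
    (f * diagonal d) x y = f x y * d y := by
  by_cases h : x ≤ y
  · simp [diagonal_apply, h]
  · simp [apply_eq_zero_of_not_le h]

lemma diagonal_mul_diagonal_of_mul_eq_one {d e : X → K} (h : ∀ x, d x * e x = 1) :
    diagonal d * diagonal e = (1 : IncidenceAlgebra K X) := by
  ext x y _
  rw [diagonal_mul_apply, diagonal_apply, one_apply]
  split_ifs <;> simp [h]

/-- The diagonal unit with diagonal entries `d`. -/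
@[simps]
def diagonalUnit (d : X → Kˣ) : (IncidenceAlgebra K X)ˣ where
  val := diagonal fun x => d x
  inv := diagonal fun x => ↑(d x)⁻¹
  val_inv := diagonal_mul_diagonal_of_mul_eq_one fun x => by simp
  inv_val := diagonal_mul_diagonal_of_mul_eq_one fun x => by simp

/-- An element commuting with everything has equal diagonal entries at comparable points. -/
lemma apply_self_eq_of_commute {z : IncidenceAlgebra K X} (hz : ∀ f, f * z = z * f) {x y : X}
    (hxy : x ≤ y) : z x x = z y y := by
  let e : IncidenceAlgebra K X :=
    ⟨fun a b => if a = x ∧ b = y then 1 else 0, fun _ _ h =>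
      if_neg fun hab => h (by rwa [hab.1, hab.2])⟩
  have he : ∀ a b, e a b = if a = x ∧ b = y then 1 else 0 := fun _ _ => rfl
  have h := congrArg (fun f : IncidenceAlgebra K X => f x y) (hz e)
  simpa [he, hxy, ite_and] using h.symm

lemma apply_self_eq_of_connected (hconn : PosetConnected X) {z : IncidenceAlgebra K X}
    (hz : ∀ f, f * z = z * f) (x y : X) : z x x = z y y := by
  induction hconn x y with
  | refl => rfl
  | tail _ hab ih =>
    rw [ih]
    exact hab.elim (apply_self_eq_of_commute hz) fun h => (apply_self_eq_of_commute hz h).symm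

section rhoLam

variable {lam : X → X} (hlam : ∀ x y : X, x ≤ y ↔ lam y ≤ lam x)

omit [LocallyFiniteOrder X] [DecidableEq X] in
lemma rhoLam_apply (f : IncidenceAlgebra K X) (x y : X) :
    rhoLam K X lam hlam f x y = f (lam y) (lam x) := rfl

omit [DecidableEq X] in
lemma rhoLam_mul (hinv : ∀ x, lam (lam x) = x) (f g : IncidenceAlgebra K X) :
    rhoLam K X lam hlam (f * g) = rhoLam K X lam hlam g * rhoLam K X lam hlam f := by
  ext x y _
  simp only [rhoLam_apply, mul_apply]
  refine Finset.sum_nbij' lam lam ?_ ?_ ?_ ?_ ?_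
  · intro a ha
    rw [Finset.mem_Icc] at ha ⊢
    rwa [hlam x, hlam _ y, hinv, and_comm]
  · intro a ha
    rw [Finset.mem_Icc] at ha ⊢
    rwa [← hlam, ← hlam, and_comm]
  · exact fun a _ => hinv a
  · exact fun a _ => hinv a
  · intro a _
    rw [hinv, mul_comm]

omit [LocallyFiniteOrder X] in
lemma rhoLam_one (hinv : ∀ x, lam (lam x) = x) :
    rhoLam K X lam hlam (1 : IncidenceAlgebra K X) = 1 := by
  ext x y _
  simp only [rhoLam_apply, one_apply, (Function.Involutive.injective hinv).eq_iff, eq_comm]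

omit [LocallyFiniteOrder X] [DecidableEq X] in
lemma rhoLam_rhoLam (hinv : ∀ x, lam (lam x) = x) (f : IncidenceAlgebra K X) :
    rhoLam K X lam hlam (rhoLam K X lam hlam f) = f := by
  ext x y _
  simp only [rhoLam_apply, hinv]

/-- The image of a unit under `ρ_λ`. -/
@[simps]
def rhoLamUnit (hinv : ∀ x, lam (lam x) = x) (u : (IncidenceAlgebra K X)ˣ) :
    (IncidenceAlgebra K X)ˣ where
  val := rhoLam K X lam hlam u
  inv := rhoLam K X lam hlam ↑u⁻¹
  val_inv := by rw [← rhoLam_mul hlam hinv, Units.inv_mul, rhoLam_one hlam hinv]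
  inv_val := by rw [← rhoLam_mul hlam hinv, Units.mul_inv, rhoLam_one hlam hinv]

end rhoLam

section rhoEps

variable {X₃ : Set X}

open Classical in
/-- The extension of `ε : X₃ → K*` to `X` by `1`. -/
noncomputable def extendEps (eps : {x : X // x ∈ X₃} → Kˣ) (x : X) : Kˣ :=
  if h : x ∈ X₃ then eps ⟨x, h⟩ else 1

omit [PartialOrder X] [LocallyFiniteOrder X] [DecidableEq X] in
lemma extendEps_of_mem (eps : {x : X // x ∈ X₃} → Kˣ) {x : X} (h : x ∈ X₃) :
    extendEps eps x = eps ⟨x, h⟩ := dif_pos h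

omit [PartialOrder X] [LocallyFiniteOrder X] [DecidableEq X] in
lemma extendEps_of_notMem (eps : {x : X // x ∈ X₃} → Kˣ) {x : X} (h : x ∉ X₃) :
    extendEps eps x = 1 := dif_neg h

lemma uEps_eq_diagonalUnit (eps : {x : X // x ∈ X₃} → Kˣ) :
    uEps K X X₃ eps = diagonalUnit (extendEps eps) := by
  ext x y _
  change (if _ : x = y then _ else _) = if x = y then _ else _
  by_cases h : x ∈ X₃ <;> simp [extendEps, h]

variable {lam : X → X} (hlam : ∀ x y : X, x ≤ y ↔ lam y ≤ lam x)

lemma rhoEps_eq (eps : {x : X // x ∈ X₃} → Kˣ) (f : IncidenceAlgebra K X) :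
    rhoEps K X X₃ eps lam hlam f = diagonalUnit (extendEps eps) * rhoLam K X lam hlam f *
      ↑(diagonalUnit (extendEps eps) : (IncidenceAlgebra K X)ˣ)⁻¹ := by
  rw [rhoEps, uEps_eq_diagonalUnit, Ring.inverse_unit]

/-- A unit intertwining `ρ_{ε₁}` and `ρ_{ε₂}` relates `ε₁` and `ε₂` at the fixed points of `λ`. -/
lemma exists_extendEps_eq_of_intertwines (hconn : PosetConnected X)
    (hinv : ∀ x, lam (lam x) = x) (eps₁ eps₂ : {x : X // x ∈ X₃} → Kˣ)
    (u : (IncidenceAlgebra K X)ˣ)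
    (hu : ∀ f, ↑u * rhoEps K X X₃ eps₁ lam hlam f * ↑u⁻¹ =
      rhoEps K X X₃ eps₂ lam hlam (↑u * f * ↑u⁻¹)) :
    ∃ g : Kˣ, ∀ x, lam x = x → ∃ c : Kˣ,
      extendEps eps₂ x = g * extendEps eps₁ x * (c * c) := by
  let v : (IncidenceAlgebra K X)ˣ := u * diagonalUnit (extendEps eps₁)
  let w : (IncidenceAlgebra K X)ˣ := diagonalUnit (extendEps eps₂) * (rhoLamUnit hlam hinv u)⁻¹
  have hvw : ∀ f : IncidenceAlgebra K X, ↑v * f * ↑v⁻¹ = ↑w * f * ↑w⁻¹ := by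
    intro f
    have h := hu (rhoLam K X lam hlam f)
    rw [rhoEps_eq, rhoEps_eq, rhoLam_mul hlam hinv, rhoLam_mul hlam hinv,
      rhoLam_rhoLam hlam hinv] at h
    simpa only [v, w, mul_inv_rev, inv_inv, Units.val_mul, val_rhoLamUnit, val_inv_rhoLamUnit,
      mul_assoc] using h
  have hz : ∀ f : IncidenceAlgebra K X, f * ↑(v⁻¹ * w) = ↑(v⁻¹ * w) * f := by
    intro f
    have h := congrArg (fun a : IncidenceAlgebra K X => ↑v⁻¹ * a * ↑w) (hvw f)
    simpa [mul_assoc] using h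
  have hne : ∀ (a : (IncidenceAlgebra K X)ˣ) (x : X),
      (a : IncidenceAlgebra K X) x x ≠ 0 := by
    intro a x h
    have := mul_apply_self (a : IncidenceAlgebra K X) ↑a⁻¹ x
    simp [h] at this
  rcases isEmpty_or_nonempty X with _ | ⟨⟨x₀⟩⟩
  · exact ⟨1, fun x => isEmptyElim x⟩
  refine ⟨Units.mk0 _ (hne (v⁻¹ * w) x₀), fun x hx => ⟨Units.mk0 _ (hne u x), ?_⟩⟩
  have hprod : (u : IncidenceAlgebra K X) * ↑(diagonalUnit (extendEps eps₁)) * ↑(v⁻¹ * w) *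
      ↑(rhoLamUnit hlam hinv u) = ↑(diagonalUnit (K := K) (extendEps eps₂)) := by
    simp only [← Units.val_mul]
    congr 1
    simp only [v, w]
    group
  have h := congrArg (fun f : IncidenceAlgebra K X => f x x) hprod
  simp only [mul_apply_self, val_diagonalUnit, diagonal_apply, val_rhoLamUnit, rhoLam_apply, hx,
    if_true, apply_self_eq_of_connected hconn hz x x₀] at h
  ext
  simp only [Units.val_mul, Units.val_mk0] at h ⊢
  rw [← h]
  ring

/-- Diagonal units satisfying the twisted congruence relation intertwine `ρ_{ε₁}` and `ρ_{ε₂}`. -/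
lemma diagonalUnit_intertwines (eps₁ eps₂ : {x : X // x ∈ X₃} → Kˣ) (g : Kˣ) (d : X → Kˣ)
    (hd : ∀ x, extendEps eps₂ x = g * d x * d (lam x) * extendEps eps₁ x)
    (f : IncidenceAlgebra K X) :
    ↑(diagonalUnit d) * rhoEps K X X₃ eps₁ lam hlam f * ↑(diagonalUnit d)⁻¹ =
      rhoEps K X X₃ eps₂ lam hlam (↑(diagonalUnit d) * f * ↑(diagonalUnit d)⁻¹) := by
  ext x y _
  simp only [rhoEps_eq, val_diagonalUnit, val_inv_diagonalUnit, mul_diagonal_apply,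
    diagonal_mul_apply, rhoLam_apply, hd, Units.val_mul, Units.val_inv_eq_inv_val]
  field_simp [Units.ne_zero]

end rhoEps

end IncidenceAlgebra

open IncidenceAlgebra in
/-- Assume `char K ≠ 2` and `X` is a connected locally finite poset satisfying condition
(M).  Let `λ` be an involution on `X` with `λ`-decomposition `(X₁, X₂, X₃)`.  For maps
`ε₁, ε₂ : X₃ → K*`, the involutions `ρ_{ε₁}` and `ρ_{ε₂}` on `I(X,K)` are equivalent
via an inner automorphism if and only if there is `g ∈ K*` such that for every `x ∈ X₃`,
`ε₂(x)·(g·ε₁(x))⁻¹` is a square in `K*`. -/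
theorem rhoEps_inner_equivalent_iff
    (K X : Type*) [Field K] [PartialOrder X] [LocallyFiniteOrder X] [DecidableEq X]
    (hchar : (2 : K) ≠ 0)
    (hconn : PosetConnected X) (hM : CondM K X)
    (lam : X → X)
    (hlam : ∀ x y : X, x ≤ y ↔ lam y ≤ lam x)
    (hlaminvo : ∀ x : X, lam (lam x) = x)
    (X₁ X₂ X₃ : Set X)
    (hX₃ : X₃ = {x : X | lam x = x})
    (hdisj12 : Disjoint X₁ X₂) (hdisj13 : Disjoint X₁ X₃) (hdisj23 : Disjoint X₂ X₃)
    (hunion : X₁ ∪ X₂ ∪ X₃ = Set.univ)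
    (hlam12 : ∀ x ∈ X₁, lam x ∈ X₂) (hlam21 : ∀ x ∈ X₂, lam x ∈ X₁)
    (hdown : ∀ x ∈ X₁, ∀ y : X, y ≤ x → y ∈ X₁)
    (hup : ∀ x ∈ X₂, ∀ y : X, x ≤ y → y ∈ X₂)
    (eps₁ eps₂ : {x : X // x ∈ X₃} → Kˣ) :
    (∃ u : (IncidenceAlgebra K X)ˣ,
        ∀ f : IncidenceAlgebra K X,
          ↑u * rhoEps K X X₃ eps₁ lam hlam f * ↑u⁻¹ =
            rhoEps K X X₃ eps₂ lam hlam (↑u * f * ↑u⁻¹)) ↔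
      (∃ g : Kˣ, ∀ x : {x : X // x ∈ X₃}, ∃ c : Kˣ, eps₂ x * (g * eps₁ x)⁻¹ = c * c) := by
  constructor
  · rintro ⟨u, hu⟩
    obtain ⟨g, hg⟩ := exists_extendEps_eq_of_intertwines hlam hconn hlaminvo eps₁ eps₂ u hu
    refine ⟨g, fun x => ?_⟩
    obtain ⟨c, hc⟩ := hg x (by simpa [hX₃] using x.2)
    rw [extendEps_of_mem _ x.2, extendEps_of_mem _ x.2] at hc
    exact ⟨c, by rw [hc, mul_inv_cancel_comm]⟩
  · rintro ⟨g, hg⟩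
    choose c hc using hg
    classical
    have h12 : ∀ {x}, x ∈ X₁ → x ∉ X₂ := fun h => Set.disjoint_left.mp hdisj12 h
    have h13 : ∀ {x}, x ∈ X₁ → x ∉ X₃ := fun h => Set.disjoint_left.mp hdisj13 h
    have h23 : ∀ {x}, x ∈ X₂ → x ∉ X₃ := fun h => Set.disjoint_left.mp hdisj23 h
    let d : X → Kˣ := fun x => if x ∈ X₂ then g⁻¹ else extendEps c x
    refine ⟨diagonalUnit d, diagonalUnit_intertwines hlam eps₁ eps₂ g d fun x => ?_⟩
    have hx : x ∈ X₁ ∪ X₂ ∪ X₃ := hunion ▸ Set.mem_univ x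
    rcases hx with (hx | hx) | hx
    · simp [d, extendEps_of_notMem _ (h13 hx), h12 hx, hlam12 x hx]
    · have hl := hlam21 x hx
      simp [d, extendEps_of_notMem _ (h23 hx), extendEps_of_notMem _ (h13 hl), h12 hl, hx]
    · have hfix : lam x = x := by simpa [hX₃] using hx
      have hx2 : x ∉ X₂ := fun h => h23 h hx
      simp only [d, hfix, hx2, if_false, extendEps_of_mem _ hx]
      rw [mul_assoc g, ← hc ⟨x, hx⟩]
      rw [mul_right_comm, mul_comm, inv_mul_cancel_right]
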